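/- With the same setup, the matrix T T* has eigenvalue q^{(d+1)n} with multiplicity 1, eigenvalue q^{dn} with multiplicity q^{n+d} − q^n, and eigenvalue 0 with multiplicity q^{d(n+1)} − q^{n+d} + q^n − 1. -/

import Mathlib

open Polynomial in
lemma aux_charpoly {X Y : Type*} [Fintype X] [Fintype Y] [DecidableEq X] [DecidableEq Y]
    [Nonempty X] [Nonempty Y] (M : Matrix (X × Y) (X × Y) ℂ) (α c : ℂ)
    (hc : c * (Fintype.card Y : ℂ) = α)
    (hM : ∀ p p', M p p' = if p.1 = p'.1 then (if p.2 = p'.2 then α else 0) else c) :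
    M.charpoly = (Polynomial.X - C α) ^ (Fintype.card X * Fintype.card Y - Fintype.card X)
      * (Polynomial.X ^ (Fintype.card X - 1) * (Polynomial.X - C (α * Fintype.card X))) := by
  set U : Matrix (X × Y) X ℂ := Matrix.of fun p x => if p.1 = x then 1 else 0 with hU
  set V : Matrix X (X × Y) ℂ := Matrix.of fun x p => if p.1 = x then 0 else c with hV
  have h1 : M = U * V - Matrix.scalar _ (-α) := by
    ext p p'
    rw [hM]
    simp only [Matrix.sub_apply, Matrix.mul_apply, hU, hV, Matrix.of_apply, Matrix.scalar_apply,
      Matrix.diagonal_apply, ite_mul, one_mul, zero_mul, Finset.sum_ite_eq, Finset.mem_univ, if_true]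
    rcases p with ⟨x, y⟩
    rcases p' with ⟨x', y'⟩
    by_cases hx : x = x'
    · by_cases hy : y = y' <;> simp [hx, hy]
    · have hx' : ¬ x' = x := fun e => hx e.symm
      simp [hx, hx']
  have h2 : V * U = Matrix.vecMulVec (fun _ : X => α) (fun _ => 1) - Matrix.scalar _ α := by
    ext x x'
    simp only [Matrix.sub_apply, Matrix.mul_apply, hU, hV, Matrix.of_apply, Matrix.scalar_apply,
      Matrix.diagonal_apply, Matrix.vecMulVec_apply, Fintype.sum_prod_type]
    have : ∀ x1 : X, (∑ y : Y, (if x1 = x then (0:ℂ) else c) * (if x1 = x' then 1 else 0))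
        = if x1 = x' then (if x1 = x then (0:ℂ) else α) else 0 := by
      intro x1
      rw [Finset.sum_const, Finset.card_univ, nsmul_eq_mul, ← hc]
      split_ifs <;> ring
    simp only [this, Finset.sum_ite_eq', Finset.mem_univ, if_true]
    by_cases hx : x = x'
    · simp [hx]
    · have hx' : ¬ x' = x := fun e => hx e.symm
      simp [hx, hx']
  have hX : 1 ≤ Fintype.card X := Fintype.card_pos
  have hY : 1 ≤ Fintype.card Y := Fintype.card_pos
  have h3 : (V * U).charpoly = (Polynomial.X + C α) ^ (Fintype.card X - 1)
      * (Polynomial.X + C α - C (α * Fintype.card X)) := by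
    rw [h2, Matrix.charpoly_sub_scalar, Matrix.charpoly_vecMulVec]
    obtain ⟨k, hk⟩ := Nat.exists_eq_add_of_le' hX
    simp [hk, dotProduct, Polynomial.smul_eq_C_mul]
    ring
  rw [h1, Matrix.charpoly_sub_scalar, Matrix.charpoly_mul_comm_of_le, h3]
  · simp [Fintype.card_prod]
    left
    ring
  · rw [Fintype.card_prod]; nlinarith

lemma aux_pow_inj {F : Type*} [Field F] [Fintype F] (b : ℕ) (hb : 0 < b)
    (hc : Nat.Coprime b (Fintype.card F - 1)) : Function.Injective fun x : F => x ^ b := by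
  intro x y hxy
  simp only at hxy
  by_cases hx : x = 0
  · subst hx
    rw [zero_pow hb.ne'] at hxy
    exact ((pow_eq_zero_iff hb.ne').1 hxy.symm).symm
  · have hy : y ≠ 0 := by
      rintro rfl
      rw [zero_pow hb.ne'] at hxy
      exact hx ((pow_eq_zero_iff hb.ne').1 hxy)
    have hz : (x / y) ^ b = 1 := by rw [div_pow, hxy, div_self (pow_ne_zero _ hy)]
    have hz' : (x / y) ^ (Fintype.card F - 1) = 1 :=
      FiniteField.pow_card_sub_one_eq_one _ (div_ne_zero hx hy)
    have : orderOf (x / y) ∣ 1 := by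
      rw [← hc]
      exact Nat.dvd_gcd (orderOf_dvd_of_pow_eq_one hz) (orderOf_dvd_of_pow_eq_one hz')
    have h1 := orderOf_eq_one_iff.1 (Nat.dvd_one.1 this)
    exact (div_eq_one_iff_eq hy).1 h1

lemma aux_fiber {F : Type*} [Field F] [Fintype F] [DecidableEq F] {n : ℕ} (w : Fin n → F)
    (hw : w ≠ 0) (k : F) :
    (∑ u : Fin n → F, if ∑ j, u j * w j = k then (1:ℂ) else 0)
      = (Fintype.card F : ℂ) ^ n / Fintype.card F := by
  obtain ⟨j0, hj⟩ := Function.ne_iff.1 hw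
  have hj : w j0 ≠ 0 := hj
  have key : ∀ k' : F, (∑ u : Fin n → F, if ∑ j, u j * w j = k' then (1:ℂ) else 0)
      = ∑ u : Fin n → F, if ∑ j, u j * w j = k then (1:ℂ) else 0 := by
    intro k'
    refine Fintype.sum_equiv (Equiv.addRight (Pi.single j0 ((k - k') / w j0))) _ _ ?_
    intro u
    have : ∑ j, (u + (Pi.single j0 ((k - k') / w j0) : Fin n → F)) j * w j = (∑ j, u j * w j) + (k - k') := by
      simp only [Pi.add_apply, add_mul, Finset.sum_add_distrib, Pi.single_apply, ite_mul, zero_mul,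
        Finset.sum_ite_eq', Finset.mem_univ, if_true]
      rw [div_mul_cancel₀ _ hj]
    change _ = if ∑ j, (u + (Pi.single j0 ((k - k') / w j0) : Fin n → F)) j * w j = k
      then (1:ℂ) else 0
    rw [this]
    congr 1
    apply propext
    constructor
    · intro e; rw [e]; ring
    · intro e; linear_combination e
  have tot : ∑ k' : F, (∑ u : Fin n → F, if ∑ j, u j * w j = k' then (1:ℂ) else 0)
      = (Fintype.card F : ℂ) ^ n := by
    rw [Finset.sum_comm]
    simp
  rw [Finset.sum_congr rfl (fun k' _ => key k'), Finset.sum_const, Finset.card_univ,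
    nsmul_eq_mul] at tot
  have hq : (Fintype.card F : ℂ) ≠ 0 := by exact_mod_cast Fintype.card_ne_zero
  rw [eq_div_iff hq, mul_comm]
  exact tot

lemma aux_pair {F : Type*} [Field F] [Fintype F] [DecidableEq F] {n : ℕ} (s s' : Fin n → F)
    (y y' g g' : F) :
    (∑ a : (Fin n → F) × F, (if y = g + (∑ j, a.1 j * s j) + a.2 then (1:ℂ) else 0)
        * (if y' = g' + (∑ j, a.1 j * s' j) + a.2 then (1:ℂ) else 0))
      = if s = s' then (if y - g = y' - g' then (Fintype.card F : ℂ) ^ n else 0)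
        else (Fintype.card F : ℂ) ^ n / Fintype.card F := by
  have h1 : ∀ u : Fin n → F, (∑ c : F, (if y = g + (∑ j, u j * s j) + c then (1:ℂ) else 0)
        * (if y' = g' + (∑ j, u j * s' j) + c then (1:ℂ) else 0))
      = if ∑ j, u j * (s' - s) j = (y' - g') - (y - g) then 1 else 0 := by
    intro u
    have : ∀ c : F, (if y = g + (∑ j, u j * s j) + c then (1:ℂ) else 0)
        = if c = y - g - ∑ j, u j * s j then 1 else 0 := by
      intro c
      congr 1
      apply propext
      constructor
      · intro e; linear_combination -e
      · intro e; linear_combination -e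
    simp only [this, ite_mul, one_mul, zero_mul, Finset.sum_ite_eq', Finset.mem_univ, if_true]
    congr 1
    apply propext
    simp only [Pi.sub_apply, mul_sub, Finset.sum_sub_distrib]
    constructor
    · intro e; linear_combination -e
    · intro e; linear_combination -e
  rw [Fintype.sum_prod_type]
  simp only [h1]
  by_cases hs : s = s'
  · subst hs
    by_cases hy : y - g = y' - g'
    · simp [hy]
    · have : ¬ (0 = (y' - g') - (y - g)) := fun e => hy (by linear_combination e)
      simp [hy, this]
  · rw [if_neg hs]
    exact aux_fiber _ (sub_ne_zero.2 (Ne.symm hs)) _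

/-- The matrix `T T*`, where `T` is the variety–point incidence matrix, has eigenvalue
`q^{(d+1)n}` with multiplicity `1`, eigenvalue `q^{dn}` with multiplicity `q^{n+d} − q^n`,
and eigenvalue `0` with multiplicity `q^{d(n+1)} − q^{n+d} + q^n − 1` (stated via its characteristic polynomial). -/
theorem stmt_6 {F : Type*} [Field F] [Fintype F] [DecidableEq F] (n d : ℕ)
    (hn : 1 ≤ n) (hd : 1 ≤ d)
    (h : Fin d → MvPolynomial (Fin n) F)
    (hdeg : ∀ i, (h i).totalDegree ≤ Fintype.card F - 1)
    (b : Fin d → Fin n → ℕ)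
    (hb : ∀ i j, 0 < b i j ∧ Nat.Coprime (b i j) (Fintype.card F - 1))
    (T : Matrix (Fin d → (Fin n → F) × F) ((Fin n → F) × (Fin d → F)) ℂ)
    (hT : ∀ (a : Fin d → (Fin n → F) × F) (pt : (Fin n → F) × (Fin d → F)),
      ((∀ i, pt.2 i = MvPolynomial.eval pt.1 (h i)
          + (∑ j, (a i).1 j * pt.1 j ^ (b i j)) + (a i).2) → T a pt = 1) ∧
      (¬ (∀ i, pt.2 i = MvPolynomial.eval pt.1 (h i)
          + (∑ j, (a i).1 j * pt.1 j ^ (b i j)) + (a i).2) → T a pt = 0)) :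
    (T * T.conjTranspose).charpoly =
      (Polynomial.X - Polynomial.C ((Fintype.card F : ℂ) ^ ((d + 1) * n)))
      * (Polynomial.X - Polynomial.C ((Fintype.card F : ℂ) ^ (d * n)))
          ^ (Fintype.card F ^ (n + d) - Fintype.card F ^ n)
      * Polynomial.X ^ (Fintype.card F ^ (d * (n + 1)) - Fintype.card F ^ (n + d)
          + Fintype.card F ^ n - 1) := by
  have hq0 : (Fintype.card F : ℂ) ≠ 0 := by exact_mod_cast Fintype.card_ne_zero
  have hq1 : 1 ≤ Fintype.card F := Fintype.card_pos
  have hTp : ∀ a pt, T a pt = ∏ i, if pt.2 i = MvPolynomial.eval pt.1 (h i)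
      + (∑ j, (a i).1 j * pt.1 j ^ (b i j)) + (a i).2 then (1:ℂ) else 0 := by
    intro a pt
    rw [Finset.prod_ite_zero]
    simp only [Finset.mem_univ, true_imp_iff, Finset.prod_const_one]
    split_ifs with hh
    · exact (hT a pt).1 hh
    · exact (hT a pt).2 hh
  have hM : ∀ p p', (T.conjTranspose * T) p p' =
      if p.1 = p'.1 then (if p.2 = p'.2 then ((Fintype.card F : ℂ) ^ n) ^ d else 0)
      else ((Fintype.card F : ℂ) ^ n / Fintype.card F) ^ d := by
    intro p p'
    have hst : ∀ a, star (T a p) = T a p := by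
      intro a
      rw [hTp, star_prod]
      refine Finset.prod_congr rfl fun i _ => ?_
      split_ifs <;> simp
    simp only [Matrix.mul_apply, Matrix.conjTranspose_apply, hst]
    simp only [hTp, ← Finset.prod_mul_distrib]
    rw [← Fintype.piFinset_univ, ← Finset.prod_univ_sum (fun _ => Finset.univ)
      (fun i (a : (Fin n → F) × F) => (if p.2 i = MvPolynomial.eval p.1 (h i)
      + (∑ j, a.1 j * p.1 j ^ (b i j)) + a.2 then (1:ℂ) else 0) *
      (if p'.2 i = MvPolynomial.eval p'.1 (h i)
      + (∑ j, a.1 j * p'.1 j ^ (b i j)) + a.2 then (1:ℂ) else 0))]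
    simp only [aux_pair (fun j => p.1 j ^ b _ j) (fun j => p'.1 j ^ b _ j)]
    rcases p with ⟨x, y⟩
    rcases p' with ⟨x', y'⟩
    by_cases hx : x = x'
    · subst hx
      simp only [if_true, sub_left_inj]
      rw [Finset.prod_ite_zero]
      simp [funext_iff]
    · have : ∀ i, ¬ ((fun j => x j ^ b i j) = fun j => x' j ^ b i j) := fun i e =>
        hx (funext fun j => aux_pow_inj (b i j) (hb i j).1 (hb i j).2 (congrFun e j))
      simp [hx, this, div_pow]
  have hle : n + d ≤ d * (n + 1) := by nlinarith
  have hle' := Nat.pow_le_pow_right hq1 hle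
  have hle2 : Fintype.card F ^ n ≤ Fintype.card F ^ (n + d) :=
    Nat.pow_le_pow_right hq1 (Nat.le_add_right n d)
  have hpos : 1 ≤ Fintype.card F ^ n := Nat.one_le_pow _ _ hq1
  have hc1 : Fintype.card (Fin d → (Fin n → F) × F) = Fintype.card F ^ (d * (n + 1)) := by
    simp only [Fintype.card_pi, Fintype.card_prod, Finset.prod_const, Finset.card_univ,
      Fintype.card_fin]
    rw [← pow_succ, ← pow_mul, mul_comm d]
  have hc2 : Fintype.card ((Fin n → F) × (Fin d → F)) = Fintype.card F ^ (n + d) := by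
    simp [pow_add]
  rw [Matrix.charpoly_mul_comm_of_le _ _ (by rw [hc1, hc2]; exact hle'),
    aux_charpoly (T.conjTranspose * T) _ _ ?_ hM, hc1, hc2]
  · simp only [Fintype.card_pi, Finset.prod_const, Finset.card_univ, Fintype.card_fin]
    rw [← pow_add (Fintype.card F) n d]
    have e1 : ((Fintype.card F : ℂ) ^ n) ^ d = (Fintype.card F : ℂ) ^ (d * n) := by
      rw [← pow_mul, mul_comm]
    have e2 : (Fintype.card F : ℂ) ^ (d * n) * ((Fintype.card F ^ n : ℕ) : ℂ)
        = (Fintype.card F : ℂ) ^ ((d + 1) * n) := by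
      push_cast; ring
    rw [e1, e2, show Fintype.card F ^ (d * (n + 1)) - Fintype.card F ^ (n + d)
          + Fintype.card F ^ n - 1 = (Fintype.card F ^ (d * (n + 1)) - Fintype.card F ^ (n + d))
          + (Fintype.card F ^ n - 1) by omega, pow_add Polynomial.X]
    ring
  · simp only [Fintype.card_pi, Finset.prod_const, Finset.card_univ, Fintype.card_fin]
    push_cast
    rw [← mul_pow, div_mul_cancel₀ _ hq0]
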